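/- arXiv:1308.4787 — 5 statements merged into one kernel-verified Lean document; each statement's English description precedes it below -/
import Mathlib

section
/- If Γ: T ⇉ X is closed-valued and outer μ-regular, then every continuous function y: T → X satisfying y_t ∈ Γ_t for μ-almost every t in fact satisfies y_t ∈ Γ_t for every t; that is, the set of continuous essential selections of Γ equals the set of continuous selections of Γ. -/
open MeasureTheory Topology Filter Set

variable {T X : Type*}

/-- `Γ⁻¹(A) = {t : Γ t ∩ A ≠ ∅}`. -/
def svPreimage (Γ : T → Set X) (A : Set X) : Set T := {t | (Γ t ∩ A).Nonempty}

section Defs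
variable [TopologicalSpace T] [MeasurableSpace T]

/-- The grill `𝓗_t^#` of the neighborhood system of `t`. -/
def grill (t : T) : Set (Set T) := {B | ∀ O ∈ 𝓝 t, (B ∩ O).Nonempty}

/-- `𝓗_t^μ = {B Borel : ∃ O ∈ 𝓗_t, μ(B ∩ O) = μ(O)}`. -/
def Hmu (μ : Measure T) (t : T) : Set (Set T) :=
  {B | MeasurableSet B ∧ ∃ O ∈ 𝓝 t, μ (B ∩ O) = μ O}

/-- `𝓗_t^{μ#} = {B Borel : B ∩ O ≠ ∅ for all O ∈ 𝓗_t^μ}`. -/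
def HmuSharp (μ : Measure T) (t : T) : Set (Set T) :=
  {B | MeasurableSet B ∧ ∀ O ∈ Hmu μ t, (B ∩ O).Nonempty}

variable [TopologicalSpace X]

/-- The outer limit `(ls Γ)_t`. -/
def outerLimit (Γ : T → Set X) (t : T) : Set X :=
  ⋂ B ∈ 𝓝 t, closure (⋃ t' ∈ B, Γ t')

/-- The inner limit `(li Γ)_t`. -/
def innerLimit (Γ : T → Set X) (t : T) : Set X :=
  ⋂ B ∈ grill t, closure (⋃ t' ∈ B, Γ t')

/-- The μ-inner limit `(μ-li Γ)_t`. -/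
def muInnerLimit (μ : Measure T) (Γ : T → Set X) (t : T) : Set X :=
  ⋂ B ∈ HmuSharp μ t, closure (⋃ t' ∈ B, Γ t')

/-- `Γ` is outer regular in measure: `(μ-li Γ)_t ⊆ cl Γ_t` for all `t`. -/
def OuterMuRegular (μ : Measure T) (Γ : T → Set X) : Prop :=
  ∀ t, muInnerLimit μ Γ t ⊆ closure (Γ t)

end Defs

/-- A measure is strictly positive if every nonempty open set has positive measure. -/
def StrictlyPositive [TopologicalSpace T] [MeasurableSpace T] (μ : Measure T) : Prop :=
  ∀ O : Set T, IsOpen O → O.Nonempty → 0 < μ O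

/-- `Γ` is inner semicontinuous if `Γ⁻¹(A)` is open for every open `A`. -/
def InnerSemicontinuous [TopologicalSpace T] [TopologicalSpace X] (Γ : T → Set X) : Prop :=
  ∀ A : Set X, IsOpen A → IsOpen (svPreimage Γ A)

/-- `Γ` is measurable if `Γ⁻¹(A)` is Borel for every open `A`. -/
def MeasurableSV [MeasurableSpace T] [TopologicalSpace X] (Γ : T → Set X) : Prop :=
  ∀ A : Set X, IsOpen A → MeasurableSet (svPreimage Γ A)

/-- Strongly Lindelöf: every subspace is Lindelöf. -/
def StronglyLindelof (T : Type*) [TopologicalSpace T] : Prop :=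
  ∀ s : Set T, IsLindelof s

/-- An open neighbourhood of `t` minus a measurable null set belongs to `𝓗_t^μ`. -/
theorem diff_mem_Hmu [TopologicalSpace T] [MeasurableSpace T] [BorelSpace T] {μ : Measure T}
    {t : T} {O N : Set T} (hO : IsOpen O) (ht : t ∈ O) (hN : MeasurableSet N) (h0 : μ N = 0) :
    O \ N ∈ Hmu μ t := by
  refine ⟨hO.measurableSet.diff hN, O, hO.mem_nhds ht, ?_⟩
  rw [inter_eq_self_of_subset_left sdiff_subset, measure_sdiff_null h0]

/-- A continuous essential selection takes its values in the μ-inner limit. -/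
theorem mem_muInnerLimit_of_ae_mem [TopologicalSpace T] [MeasurableSpace T] [BorelSpace T]
    [TopologicalSpace X] {μ : Measure T} {Γ : T → Set X} {y : T → X} (hy : Continuous y)
    (hae : ∀ᵐ t ∂μ, y t ∈ Γ t) (t : T) : y t ∈ muInnerLimit μ Γ t := by
  obtain ⟨N, hsub, hN, h0⟩ := exists_measurable_superset_of_null (ae_iff.mp hae)
  refine mem_iInter₂.mpr fun B hB => mem_closure_iff.mpr fun V hV hyV => ?_
  obtain ⟨s, hsB, hsV, hsN⟩ := hB.2 _ (diff_mem_Hmu (hV.preimage hy) hyV hN h0)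
  have hs : y s ∈ Γ s := by
    by_contra h
    exact hsN (hsub h)
  exact ⟨y s, hsV, mem_iUnion₂.mpr ⟨s, hsB, hs⟩⟩

/-- if `Γ` is closed-valued and outer μ-regular, then continuous
essential selections of `Γ` are exactly the continuous selections of `Γ`. -/
theorem essential_selections_eq_selections
    [TopologicalSpace T] [MeasurableSpace T] [BorelSpace T] [TopologicalSpace X]
    (μ : Measure T) (hμ : StrictlyPositive μ) (Γ : T → Set X)
    (hcl : ∀ t, IsClosed (Γ t)) (hreg : OuterMuRegular μ Γ) :
    {y : T → X | Continuous y ∧ ∀ᵐ t ∂μ, y t ∈ Γ t}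
      = {y : T → X | Continuous y ∧ ∀ t, y t ∈ Γ t} := by
  ext y
  refine and_congr_right fun hy => ⟨fun hae t => ?_, ae_of_all μ⟩
  exact (hcl t).closure_subset (hreg t (mem_muInnerLimit_of_ae_mem hy hae t))
end

section
/- If Γ: T ⇉ X is measurable (Γ⁻¹(A) = {t : Γ_t∩A ≠ ∅} is Borel for every open A ⊆ X), then for every t ∈ T, (μ-li Γ)_t = {x ∈ X : Γ⁻¹(A) ∈ 𝓗_t^μ for every open neighborhood A of x}. -/
open MeasureTheory Topology Filter Set

variable {T X : Type*}

/-- `𝓗_t^μ` is closed under passing to Borel supersets. -/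
theorem Hmu_mono [TopologicalSpace T] [MeasurableSpace T] {μ : Measure T} {t : T} {B C : Set T}
    (hB : B ∈ Hmu μ t) (hC : MeasurableSet C) (hBC : B ⊆ C) : C ∈ Hmu μ t := by
  obtain ⟨-, O, hO, hμO⟩ := hB
  exact ⟨hC, O, hO, le_antisymm (measure_mono inter_subset_right)
    (hμO.ge.trans (measure_mono (inter_subset_inter_left O hBC)))⟩

/-- A Borel set outside `𝓗_t^μ` has its complement in `𝓗_t^{μ#}`. -/
theorem compl_mem_HmuSharp [TopologicalSpace T] [MeasurableSpace T] {μ : Measure T} {t : T}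
    {B : Set T} (hB : MeasurableSet B) (hBt : B ∉ Hmu μ t) : Bᶜ ∈ HmuSharp μ t := by
  refine ⟨hB.compl, fun O hO => ?_⟩
  by_contra hne
  refine hBt (Hmu_mono hO hB fun s hs => ?_)
  by_contra hsB
  exact hne ⟨s, hsB, hs⟩

/-- for a measurable mapping `Γ`, the μ-inner limit is the set of
points all of whose open neighborhoods `A` satisfy `Γ⁻¹(A) ∈ 𝓗_t^μ`. -/
theorem muInnerLimit_eq_of_measurable
    [TopologicalSpace T] [MeasurableSpace T] [BorelSpace T] [TopologicalSpace X]
    (μ : Measure T) (hμ : StrictlyPositive μ) (Γ : T → Set X)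
    (hmeas : MeasurableSV Γ) (t : T) :
    muInnerLimit μ Γ t
      = {x : X | ∀ A : Set X, IsOpen A → x ∈ A → svPreimage Γ A ∈ Hmu μ t} := by
  ext x
  simp only [muInnerLimit, mem_iInter, mem_ofPred_eq]
  constructor
  · intro hx A hA hxA
    by_contra hAt
    obtain ⟨y, hyA, hy⟩ :=
      mem_closure_iff.1 (hx _ (compl_mem_HmuSharp (hmeas A hA) hAt)) A hA hxA
    obtain ⟨s, hs, hys⟩ := mem_iUnion₂.1 hy
    exact hs ⟨y, hys, hyA⟩
  · intro hx B hB
    refine mem_closure_iff.2 fun A hA hxA => ?_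
    obtain ⟨s, hsB, y, hys, hyA⟩ := hB.2 _ (hx A hA hxA)
    exact ⟨y, hyA, mem_iUnion₂.2 ⟨s, hsB, hys⟩⟩
end

section
/- If Γ: T ⇉ X and Γ̃: T ⇉ X are closed-valued set-valued mappings with Γ_t = Γ̃_t for μ-almost every t, then (μ-li Γ)_t = (μ-li Γ̃)_t for every t ∈ T. -/
open MeasureTheory Topology Filter Set

variable {T X : Type*}

theorem HmuSharp.sdiff_null [TopologicalSpace T] [MeasurableSpace T] {μ : Measure T} {t : T}
    {B N : Set T} (hB : B ∈ HmuSharp μ t) (hN : MeasurableSet N) (hN0 : μ N = 0) :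
    B \ N ∈ HmuSharp μ t := by
  refine ⟨hB.1.diff hN, fun O ⟨hO, U, hU, hOU⟩ => ?_⟩
  have hmem : O \ N ∈ Hmu μ t := by
    refine ⟨hO.diff hN, U, hU, ?_⟩
    rw [inter_comm, ← inter_sdiff_assoc, measure_sdiff_null hN0, inter_comm, hOU]
  obtain ⟨s, hsB, hsO, hsN⟩ := hB.2 _ hmem
  exact ⟨s, ⟨hsB, hsN⟩, hsO⟩

theorem muInnerLimit_subset_of_ae_subset [TopologicalSpace T] [MeasurableSpace T]
    [TopologicalSpace X] {μ : Measure T} {Γ Γ' : T → Set X}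
    (h : ∀ᵐ t ∂μ, Γ t ⊆ Γ' t) (t : T) :
    muInnerLimit μ Γ t ⊆ muInnerLimit μ Γ' t := by
  obtain ⟨N, hsub, hN, hN0⟩ := exists_measurable_superset_of_null (ae_iff.mp h)
  refine subset_iInter₂ fun B hB =>
    (biInter_subset_of_mem (HmuSharp.sdiff_null hB hN hN0)).trans (closure_mono ?_)
  refine iUnion₂_subset fun s hs => ?_
  have hΓ : Γ s ⊆ Γ' s := not_not.mp fun hn => hs.2 (hsub hn)
  exact hΓ.trans (subset_biUnion_of_mem (u := Γ') hs.1)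

/-- the μ-inner limit is invariant under changes of the (closed-valued)
mapping on μ-null sets. -/
theorem muInnerLimit_congr_ae
    [TopologicalSpace T] [MeasurableSpace T] [BorelSpace T] [TopologicalSpace X]
    (μ : Measure T) (hμ : StrictlyPositive μ) (Γ Γ' : T → Set X)
    (hcl : ∀ t, IsClosed (Γ t)) (hcl' : ∀ t, IsClosed (Γ' t))
    (hae : ∀ᵐ t ∂μ, Γ t = Γ' t) (t : T) :
    muInnerLimit μ Γ t = muInnerLimit μ Γ' t := by
  exact (muInnerLimit_subset_of_ae_subset (hae.mono fun _ h => h.le) t).antisymm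
    (muInnerLimit_subset_of_ae_subset (hae.mono fun _ h => h.ge) t)
end

section
/- Let T = [0,1] with the standard topology, μ Lebesgue measure, and define Γ: [0,1] ⇉ ℝ by Γ_t = {2^{-n}} ∪ [1,2] for t ∈ (2^{-(n+1)}, 2^{-n}) and n ∈ ℕ, and Γ_t = [1,2] otherwise (at t = 0 and at the dyadic points 2^{-n}). Then Γ is inner semicontinuous and closed nonempty-valued, (μ-li Γ)_0 = {0} ∪ [1,2], and (μ-li Γ)_t = [1,2] whenever t = 2^{-n} for some n ∈ ℕ; in particular, t ↦ (μ-li Γ)_t is not inner semicontinuous at 0. -/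
open MeasureTheory Topology Filter Set

variable {T X : Type*}

/-- Pointwise inner semicontinuity at `t`. -/
def InnerSemicontinuousAt [TopologicalSpace T] [TopologicalSpace X]
    (Γ : T → Set X) (t : T) : Prop :=
  ∀ A : Set X, IsOpen A → (Γ t ∩ A).Nonempty → svPreimage Γ A ∈ 𝓝 t

attribute [local instance] MeasureTheory.Measure.Subtype.measureSpace

/-- The mapping of Example `ex:nisc`: `Γ_t = {2^{-n}} ∪ [1,2]` for
`t ∈ (2^{-(n+1)}, 2^{-n})`, and `Γ_t = [1,2]` otherwise. -/
noncomputable def exampleMap (t : ↥(Set.Icc (0:ℝ) 1)) : Set ℝ :=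
  Set.Icc 1 2 ∪
    {x : ℝ | ∃ n : ℕ, x = 2 ^ (-(n:ℤ)) ∧
      (t : ℝ) ∈ Set.Ioo ((2:ℝ) ^ (-(n:ℤ) - 1)) ((2:ℝ) ^ (-(n:ℤ)))}

lemma mem_HmuSharp_of_measure_inter_ne_zero [TopologicalSpace T] [MeasurableSpace T]
    {μ : Measure T} [IsFiniteMeasure μ] {t : T} {B : Set T} (hB : MeasurableSet B)
    (h : ∀ U ∈ 𝓝 t, μ (B ∩ U) ≠ 0) : B ∈ HmuSharp μ t := by
  refine ⟨hB, ?_⟩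
  rintro O ⟨hO, U, hU, hOU⟩
  by_contra hne
  rw [Set.not_nonempty_iff_eq_empty] at hne
  refine h U hU (measure_mono_null (t := U \ O) ?_ ?_)
  · rintro x ⟨hxB, hxU⟩
    refine ⟨hxU, fun hxO => ?_⟩
    have : x ∈ B ∩ O := ⟨hxB, hxO⟩
    simp [hne] at this
  · have h1 := measure_inter_add_sdiff (μ := μ) U hO
    rw [Set.inter_comm, hOU] at h1
    exact (ENNReal.add_right_inj (measure_ne_top μ U)).1 (h1.trans (add_zero _).symm)

lemma volume_Icc_subtype_apply (s : Set ↥(Set.Icc (0:ℝ) 1)) :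
    (volume : Measure ↥(Set.Icc (0:ℝ) 1)) s = volume (Subtype.val '' s) :=
  comap_subtype_coe_apply measurableSet_Icc volume s

lemma isFiniteMeasure_volume_Icc :
    IsFiniteMeasure (volume : Measure ↥(Set.Icc (0:ℝ) 1)) := by
  refine ⟨?_⟩
  rw [volume_Icc_subtype_apply, Set.image_univ, Subtype.range_coe]
  exact measure_Icc_lt_top

lemma Ioo_mem_HmuSharp {a b : ℝ} (hab : a < b) (hsub : Set.Ioo a b ⊆ Set.Icc 0 1)
    {t : ↥(Set.Icc (0:ℝ) 1)} (ht : (t : ℝ) ∈ Set.Icc a b) :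
    {s : ↥(Set.Icc (0:ℝ) 1) | (s : ℝ) ∈ Set.Ioo a b} ∈ HmuSharp volume t := by
  have := isFiniteMeasure_volume_Icc
  refine mem_HmuSharp_of_measure_inter_ne_zero
    (measurable_subtype_coe measurableSet_Ioo) fun U hU => ?_
  obtain ⟨V, hV, hVU⟩ := mem_nhds_subtype _ _ _ |>.1 hU
  obtain ⟨W, hWV, hW, htW⟩ := mem_nhds_iff.1 hV
  rw [← closure_Ioo hab.ne] at ht
  have hne := mem_closure_iff.1 ht W hW htW
  rw [volume_Icc_subtype_apply]
  refine ((hW.inter isOpen_Ioo).measure_pos volume hne).ne' ∘ measure_mono_null ?_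
  rintro x ⟨hxW, hx⟩
  exact ⟨⟨x, hsub hx⟩, ⟨hx, hVU (hWV hxW)⟩, rfl⟩

lemma univ_mem_Hmu [TopologicalSpace T] [MeasurableSpace T] (μ : Measure T) (t : T) :
    Set.univ ∈ Hmu μ t :=
  ⟨MeasurableSet.univ, Set.univ, univ_mem, by simp⟩

lemma subset_muInnerLimit [TopologicalSpace T] [MeasurableSpace T] [TopologicalSpace X]
    (μ : Measure T) {Γ : T → Set X} {S : Set X} (h : ∀ t, S ⊆ Γ t) (t : T) :
    S ⊆ muInnerLimit μ Γ t := by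
  intro x hx
  refine Set.mem_iInter₂.2 fun B hB => subset_closure ?_
  obtain ⟨s, hs, -⟩ := hB.2 _ (univ_mem_Hmu μ t)
  exact Set.mem_biUnion hs (h s hx)

lemma muInnerLimit_subset_of_isClosed [TopologicalSpace T] [MeasurableSpace T]
    [TopologicalSpace X] {μ : Measure T} {Γ : T → Set X} {t : T} {B : Set T}
    (hB : B ∈ HmuSharp μ t) {C : Set X} (hC : IsClosed C) (h : ∀ s ∈ B, Γ s ⊆ C) :
    muInnerLimit μ Γ t ⊆ C :=
  (Set.biInter_subset_of_mem hB).trans (closure_minimal (Set.iUnion₂_subset h) hC)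

lemma le_of_mem_dyadic_Ioo {t : ℝ} {m n : ℕ}
    (hm : t ∈ Set.Ioo ((2:ℝ) ^ (-(m:ℤ) - 1)) ((2:ℝ) ^ (-(m:ℤ))))
    (hn : t ∈ Set.Ioo ((2:ℝ) ^ (-(n:ℤ) - 1)) ((2:ℝ) ^ (-(n:ℤ)))) : m ≤ n := by
  have h := (zpow_lt_zpow_iff_right₀ (one_lt_two (α := ℝ))).1 (hn.1.trans hm.2)
  omega

lemma eq_of_mem_dyadic_Ioo {t : ℝ} {m n : ℕ}
    (hm : t ∈ Set.Ioo ((2:ℝ) ^ (-(m:ℤ) - 1)) ((2:ℝ) ^ (-(m:ℤ))))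
    (hn : t ∈ Set.Ioo ((2:ℝ) ^ (-(n:ℤ) - 1)) ((2:ℝ) ^ (-(n:ℤ)))) : m = n :=
  (le_of_mem_dyadic_Ioo hm hn).antisymm (le_of_mem_dyadic_Ioo hn hm)

lemma two_zpow_neg_le_one (n : ℕ) : (2:ℝ) ^ (-(n:ℤ)) ≤ 1 :=
  zpow_le_one_of_nonpos₀ one_le_two (by omega)

lemma two_zpow_sub_one (k : ℤ) : (2:ℝ) ^ (k - 1) = 2 ^ k / 2 :=
  zpow_sub_one₀ two_ne_zero k

lemma exists_mem_dyadic_Ioc {t : ℝ} (h0 : 0 < t) (h1 : t ≤ 1) :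
    ∃ n : ℕ, t ∈ Set.Ioc ((2:ℝ) ^ (-(n:ℤ) - 1)) ((2:ℝ) ^ (-(n:ℤ))) := by
  obtain ⟨n, hn, hn'⟩ := exists_nat_pow_near_of_lt_one h0 h1
    (by norm_num : (0:ℝ) < 2⁻¹) (by norm_num)
  refine ⟨n, ?_, ?_⟩
  · rw [two_zpow_sub_one, zpow_neg, zpow_natCast, ← inv_pow]
    rwa [pow_succ, ← div_eq_mul_inv] at hn
  · rwa [zpow_neg, zpow_natCast, ← inv_pow]

lemma dyadic_Ioo_mem_HmuSharp (n : ℕ) {t : ↥(Set.Icc (0:ℝ) 1)}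
    (ht : (t : ℝ) ∈ Set.Icc ((2:ℝ) ^ (-(n:ℤ) - 1)) ((2:ℝ) ^ (-(n:ℤ)))) :
    {s : ↥(Set.Icc (0:ℝ) 1) |
      (s : ℝ) ∈ Set.Ioo ((2:ℝ) ^ (-(n:ℤ) - 1)) ((2:ℝ) ^ (-(n:ℤ)))} ∈ HmuSharp volume t :=
  Ioo_mem_HmuSharp (zpow_lt_zpow_right₀ one_lt_two (by omega))
    (fun _ hx => ⟨(zpow_pos two_pos _).le.trans hx.1.le, hx.2.le.trans (two_zpow_neg_le_one n)⟩)
    ht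

lemma Icc_subset_exampleMap (t : ↥(Set.Icc (0:ℝ) 1)) : Set.Icc 1 2 ⊆ exampleMap t :=
  Set.subset_union_left

lemma innerSemicontinuous_exampleMap : InnerSemicontinuous exampleMap := by
  intro A _
  by_cases hA : (Set.Icc 1 2 ∩ A).Nonempty
  · convert isOpen_univ
    exact Set.eq_univ_of_forall fun t =>
      hA.mono (Set.inter_subset_inter_left _ (Icc_subset_exampleMap t))
  · have : svPreimage exampleMap A = ⋃ (n : ℕ) (_ : (2:ℝ) ^ (-(n:ℤ)) ∈ A),
        Subtype.val ⁻¹' Set.Ioo ((2:ℝ) ^ (-(n:ℤ) - 1)) ((2:ℝ) ^ (-(n:ℤ))) := by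
      ext t
      simp only [Set.mem_iUnion]
      constructor
      · rintro ⟨x, hx | ⟨n, rfl, hn⟩, hxA⟩
        · exact (hA ⟨x, hx, hxA⟩).elim
        · exact ⟨n, hxA, hn⟩
      · rintro ⟨n, hnA, hn⟩
        exact ⟨_, Or.inr ⟨n, rfl, hn⟩, hnA⟩
    rw [this]
    exact isOpen_iUnion fun n => isOpen_iUnion fun _ =>
      isOpen_Ioo.preimage continuous_subtype_val

lemma isClosed_exampleMap (t : ↥(Set.Icc (0:ℝ) 1)) : IsClosed (exampleMap t) := by
  refine isClosed_Icc.union (Set.Subsingleton.isClosed ?_)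
  rintro x ⟨m, rfl, hm⟩ y ⟨n, rfl, hn⟩
  rw [eq_of_mem_dyadic_Ioo hm hn]

lemma dyadic_Ioo_inter_Iio_mem_Hmu (h0 : (0:ℝ) ∈ Set.Icc (0:ℝ) 1) {ε : ℝ} (hε : 0 < ε) :
    {t : ↥(Set.Icc (0:ℝ) 1) | (t : ℝ) < ε ∧
      ∃ n : ℕ, (t : ℝ) ∈ Set.Ioo ((2:ℝ) ^ (-(n:ℤ) - 1)) ((2:ℝ) ^ (-(n:ℤ)))} ∈
      Hmu volume ⟨0, h0⟩ := by
  refine ⟨?_, {t | (t : ℝ) < ε}, ?_, ?_⟩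
  · rw [Set.ofPred_and, Set.ofPred_exists]
    exact (measurable_subtype_coe measurableSet_Iio).inter
      (MeasurableSet.iUnion fun n => measurable_subtype_coe measurableSet_Ioo)
  · exact (isOpen_Iio.preimage continuous_subtype_val).mem_nhds hε
  · rw [Set.inter_comm]
    refine measure_inter_conull' ?_
    rw [volume_Icc_subtype_apply]
    refine Set.Countable.measure_zero
      (((Set.countable_range fun n : ℕ => (2:ℝ) ^ (-(n:ℤ))).insert 0).mono ?_) _
    rintro _ ⟨t, ⟨htε, ht⟩, rfl⟩
    rcases t.2.1.eq_or_lt with h | h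
    · exact Or.inl h.symm
    · obtain ⟨n, hn⟩ := exists_mem_dyadic_Ioc h t.2.2
      refine Or.inr ⟨n, ?_⟩
      by_contra hne
      exact ht ⟨htε, n, hn.1, lt_of_le_of_ne hn.2 (Ne.symm hne)⟩

lemma muInnerLimit_exampleMap_zero (h0 : (0:ℝ) ∈ Set.Icc (0:ℝ) 1) :
    muInnerLimit volume exampleMap ⟨0, h0⟩ = {0} ∪ Set.Icc 1 2 := by
  apply Set.Subset.antisymm
  · intro x hx
    have key : ∀ ε : ℝ, 0 < ε → ε ≤ 1 → x ∈ Set.Icc 1 2 ∪ Set.Icc 0 (2 * ε) := by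
      intro ε hε hε1
      refine muInnerLimit_subset_of_isClosed
        (Ioo_mem_HmuSharp (t := ⟨0, h0⟩) hε
          (fun y hy => ⟨hy.1.le, hy.2.le.trans hε1⟩) ⟨le_rfl, hε.le⟩)
        (isClosed_Icc.union isClosed_Icc) ?_ hx
      rintro s hs y (hy | ⟨n, rfl, hn⟩)
      · exact Or.inl hy
      · refine Or.inr ⟨(zpow_pos two_pos _).le, ?_⟩
        have h1 := hn.1.trans hs.2
        rw [two_zpow_sub_one] at h1
        linarith
    by_cases hx' : x ∈ Set.Icc 1 2
    · exact Or.inr hx'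
    · have hx0 : 0 ≤ x := ((key 1 one_pos le_rfl).resolve_left hx').1
      refine Or.inl (le_antisymm (le_of_forall_pos_le_add fun ε hε => ?_) hx0)
      have h1 := ((key (min (ε / 2) 1) (by positivity) (min_le_right _ _)).resolve_left hx').2
      have h2 := min_le_left (ε / 2) 1
      linarith
  · refine Set.union_subset (Set.singleton_subset_iff.2 ?_)
      (subset_muInnerLimit _ Icc_subset_exampleMap _)
    refine Set.mem_iInter₂.2 fun B hB => Metric.mem_closure_iff.2 fun ε hε => ?_
    obtain ⟨t, htB, htε, n, hn⟩ := hB.2 _ (dyadic_Ioo_inter_Iio_mem_Hmu h0 (half_pos hε))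
    refine ⟨_, Set.mem_biUnion htB (Or.inr ⟨n, rfl, hn⟩), ?_⟩
    have h1 := hn.1.trans htε
    rw [two_zpow_sub_one] at h1
    rw [dist_comm, Real.dist_eq, sub_zero, abs_of_pos (zpow_pos two_pos _)]
    linarith

lemma muInnerLimit_exampleMap_subset (n : ℕ) {t : ↥(Set.Icc (0:ℝ) 1)}
    (ht : (t : ℝ) ∈ Set.Icc ((2:ℝ) ^ (-(n:ℤ) - 1)) ((2:ℝ) ^ (-(n:ℤ)))) :
    muInnerLimit volume exampleMap t ⊆ Set.Icc 1 2 ∪ {(2:ℝ) ^ (-(n:ℤ))} := by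
  refine muInnerLimit_subset_of_isClosed (dyadic_Ioo_mem_HmuSharp n ht)
    (isClosed_Icc.union isClosed_singleton) ?_
  rintro s hs y (hy | ⟨m, rfl, hm⟩)
  · exact Or.inl hy
  · rw [eq_of_mem_dyadic_Ioo hm hs]
    exact Or.inr rfl

lemma muInnerLimit_exampleMap_dyadic (n : ℕ) (hn : (2:ℝ) ^ (-(n:ℤ)) ∈ Set.Icc (0:ℝ) 1) :
    muInnerLimit volume exampleMap ⟨(2:ℝ) ^ (-(n:ℤ)), hn⟩ = Set.Icc 1 2 := by
  refine Set.Subset.antisymm (fun x hx => ?_) (subset_muInnerLimit _ Icc_subset_exampleMap _)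
  have hl := muInnerLimit_exampleMap_subset n
    ⟨zpow_le_zpow_right₀ one_le_two (by omega), le_rfl⟩ hx
  rcases hl with hl | rfl
  · exact hl
  cases n with
  | zero => norm_num
  | succ m =>
    have hr := muInnerLimit_exampleMap_subset m
      ⟨zpow_le_zpow_right₀ one_le_two (by push_cast; omega),
        zpow_le_zpow_right₀ one_le_two (by push_cast; omega)⟩ hx
    refine hr.resolve_right fun h => ?_
    have h' := zpow_right_injective₀ (two_pos (α := ℝ)) (by norm_num) h
    push_cast at h'
    omega

lemma not_innerSemicontinuousAt_muInnerLimit_exampleMap (h0 : (0:ℝ) ∈ Set.Icc (0:ℝ) 1) :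
    ¬ InnerSemicontinuousAt (muInnerLimit volume exampleMap) ⟨0, h0⟩ := by
  intro h
  have h1 := h (Set.Iio 1) isOpen_Iio
    ⟨0, by rw [muInnerLimit_exampleMap_zero]; exact Or.inl rfl, Set.mem_Iio.2 one_pos⟩
  obtain ⟨ε, hε, hball⟩ := Metric.mem_nhds_iff.1 h1
  obtain ⟨n, hn⟩ := exists_pow_lt_of_lt_one hε (by norm_num : (2⁻¹:ℝ) < 1)
  rw [inv_pow, ← zpow_natCast, ← zpow_neg] at hn
  have hpos : (0:ℝ) < 2 ^ (-(n:ℤ)) := zpow_pos two_pos _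
  have hmem : (2:ℝ) ^ (-(n:ℤ)) ∈ Set.Icc (0:ℝ) 1 := ⟨hpos.le, two_zpow_neg_le_one n⟩
  obtain ⟨x, hx, hx1⟩ := @hball ⟨_, hmem⟩ (by
    rw [Metric.mem_ball, Subtype.dist_eq, Real.dist_eq, sub_zero, abs_of_pos hpos]
    exact hn)
  rw [muInnerLimit_exampleMap_dyadic] at hx
  exact absurd hx.1 (not_le.2 hx1)

/-- the example mapping is inner semicontinuous and closed
nonempty-valued, its μ-inner limit at the origin is `{0} ∪ [1,2]` while at the dyadic
points `2^{-n}` it is `[1,2]`; in particular the μ-inner limit is not inner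
semicontinuous at the origin. -/
theorem exampleMap_not_isc
    (h0 : (0:ℝ) ∈ Set.Icc (0:ℝ) 1) :
    InnerSemicontinuous exampleMap ∧
    (∀ t, IsClosed (exampleMap t) ∧ (exampleMap t).Nonempty) ∧
    muInnerLimit volume exampleMap ⟨0, h0⟩ = {0} ∪ Set.Icc 1 2 ∧
    (∀ (n : ℕ) (hn : (2:ℝ) ^ (-(n:ℤ)) ∈ Set.Icc (0:ℝ) 1),
      muInnerLimit volume exampleMap ⟨(2:ℝ) ^ (-(n:ℤ)), hn⟩ = Set.Icc 1 2) ∧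
    ¬ InnerSemicontinuousAt (muInnerLimit volume exampleMap) ⟨0, h0⟩ := by
  exact ⟨innerSemicontinuous_exampleMap,
    fun t => ⟨isClosed_exampleMap t, 1, Icc_subset_exampleMap t (by norm_num)⟩,
    muInnerLimit_exampleMap_zero h0, muInnerLimit_exampleMap_dyadic,
    not_innerSemicontinuousAt_muInnerLimit_exampleMap h0⟩
end

section
/- Let T ⊂ ℝⁿ be compact, μ a strictly positive σ-finite Radon measure on T, and h a convex normal integrand on T×ℝᵈ such that dom h is inner semicontinuous with int dom h_t ≠ ∅ for all t, I_h is finite on {y ∈ C(T;ℝᵈ) : ∃r>0 with 𝔹(y_t,r) ⊆ dom h_t for μ-a.e. t}, and dom h is outer μ-regular. Then the interior of dom I_h with respect to the supremum norm on C(T;ℝᵈ) equals C(T; int dom h), the set of continuous functions y with y_t ∈ int dom h_t for every t. -/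
open MeasureTheory Topology Filter Set

variable {T X : Type*}

open scoped ENNReal RealInnerProductSpace

noncomputable section

variable {d : ℕ}

/-- The extended-real integral, with the convention that it is `+∞` unless the
positive part is integrable. -/
def eIntegral [MeasurableSpace T] (μ : Measure T) (f : T → EReal) : EReal :=
  if (∫⁻ t, ((f t) ⊔ 0).abs ∂μ) = ⊤ then ⊤
  else ((∫⁻ t, ((f t) ⊔ 0).abs ∂μ : ℝ≥0∞) : EReal)
    - ((∫⁻ t, ((-(f t)) ⊔ 0).abs ∂μ : ℝ≥0∞) : EReal)

/-- The epigraph of an extended-real-valued function. -/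
def epigraph (f : EuclideanSpace ℝ (Fin d) → EReal) : Set (EuclideanSpace ℝ (Fin d) × ℝ) :=
  {p | f p.1 ≤ (p.2 : EReal)}

/-- A convex normal integrand: the epigraphs form a closed convex-valued measurable
mapping. -/
def IsConvexNormalIntegrand [MeasurableSpace T]
    (h : T → EuclideanSpace ℝ (Fin d) → EReal) : Prop :=
  (∀ t, IsClosed (epigraph (h t)) ∧ Convex ℝ (epigraph (h t))) ∧
  (∀ A : Set (EuclideanSpace ℝ (Fin d) × ℝ), IsOpen A →
    MeasurableSet {t | (epigraph (h t) ∩ A).Nonempty})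

/-- The domain `dom h_t = {x : h_t(x) < ∞}` of an integrand. -/
def dom (h : T → EuclideanSpace ℝ (Fin d) → EReal) (t : T) : Set (EuclideanSpace ℝ (Fin d)) :=
  {x | h t x < ⊤}

/-- The convex conjugate `f^*(v) = sup_x {x·v − f(x)}`. -/
def conj (f : EuclideanSpace ℝ (Fin d) → EReal) (v : EuclideanSpace ℝ (Fin d)) : EReal :=
  ⨆ x : EuclideanSpace ℝ (Fin d), ((⟪x, v⟫ : ℝ) : EReal) - f x

/-- The recession function `g^∞(v) = sup_{α>0} (g(αv + w) − g(w))/α`, `w ∈ dom g`. -/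
def recessionFn (g : EuclideanSpace ℝ (Fin d) → EReal) (v : EuclideanSpace ℝ (Fin d)) : EReal :=
  ⨆ (w : EuclideanSpace ℝ (Fin d)) (_ : g w < ⊤) (α : ℝ) (_ : 0 < α),
    ((α⁻¹ : ℝ) : EReal) * (g (α • v + w) - g w)

/-- The integral of a function against a signed measure, via the Jordan decomposition. -/
def sintegral [MeasurableSpace T] (s : SignedMeasure T) (f : T → ℝ) : ℝ :=
  ∫ t, f t ∂s.toJordanDecomposition.posPart - ∫ t, f t ∂s.toJordanDecomposition.negPart

/-- The pairing `⟨y, θ⟩ = ∫ y dθ` between `ℝᵈ`-valued functions and `ℝᵈ`-valued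
measures (given by their coordinate signed measures). -/
def pairing [MeasurableSpace T] (y : T → EuclideanSpace ℝ (Fin d))
    (θ : Fin d → SignedMeasure T) : ℝ :=
  ∑ i, sintegral (θ i) (fun t => y t i)

/-- An `ℝᵈ`-valued measure is Radon if each coordinate's total variation is inner
regular with respect to compact sets. -/
def IsRadonVM [TopologicalSpace T] [MeasurableSpace T] (θ : Fin d → SignedMeasure T) : Prop :=
  ∀ i, (θ i).totalVariation.InnerRegular

/-- The `ℝᵈ`-valued Radon–Nikodym derivative of `θ` with respect to `μ`. -/
def vDeriv [MeasurableSpace T] (θ : Fin d → SignedMeasure T) (μ : Measure T) (t : T) :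
    EuclideanSpace ℝ (Fin d) :=
  (EuclideanSpace.equiv (Fin d) ℝ).symm (fun i => (θ i).rnDeriv μ t)

/-- The coordinatewise singular part of `θ` with respect to `μ`. -/
def vSingularPart [MeasurableSpace T] (θ : Fin d → SignedMeasure T) (μ : Measure T) :
    Fin d → SignedMeasure T :=
  fun i => (θ i).singularPart μ

/-- The (Euclidean) total variation measure `|θ|` of an `ℝᵈ`-valued measure. -/
def vVariation [MeasurableSpace T] (θ : Fin d → SignedMeasure T) : Measure T :=
  (∑ i, (θ i).totalVariation).withDensity
    (fun t => (‖vDeriv θ (∑ i, (θ i).totalVariation) t‖₊ : ℝ≥0∞))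

/-- The functional `J_{h^*}(θ) = ∫ h^*(dθ/dμ) dμ + ∫ (h^*)^∞(dθ^s/d|θ^s|) d|θ^s|`. -/
def Jstar [TopologicalSpace T] [MeasurableSpace T] (μ : Measure T)
    (h : T → EuclideanSpace ℝ (Fin d) → EReal) (θ : Fin d → SignedMeasure T) : EReal :=
  eIntegral μ (fun t => conj (h t) (vDeriv θ μ t)) +
  eIntegral (vVariation (vSingularPart θ μ))
    (fun t => recessionFn (conj (h t))
      (vDeriv (vSingularPart θ μ) (vVariation (vSingularPart θ μ)) t))

/-- The integral functional `I_h(y) = ∫ h_t(y_t) dμ`. -/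
def Ih [MeasurableSpace T] (μ : Measure T) (h : T → EuclideanSpace ℝ (Fin d) → EReal)
    (y : T → EuclideanSpace ℝ (Fin d)) : EReal :=
  eIntegral μ (fun t => h t (y t))

/-- The conjugate of `I_h` on `C_b`, as a functional on `M_b`. -/
def Iconj [TopologicalSpace T] [MeasurableSpace T] (μ : Measure T)
    (h : T → EuclideanSpace ℝ (Fin d) → EReal) (θ : Fin d → SignedMeasure T) : EReal :=
  ⨆ (y : T → EuclideanSpace ℝ (Fin d))
    (_ : Continuous y ∧ Bornology.IsBounded (Set.range y)),
    ((pairing y θ : ℝ) : EReal) - Ih μ h y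

/-- The conjugate of `J_{h^*}` on `M_b`, as a functional on `C_b`. -/
def Jconj [TopologicalSpace T] [MeasurableSpace T] (μ : Measure T)
    (h : T → EuclideanSpace ℝ (Fin d) → EReal) (y : T → EuclideanSpace ℝ (Fin d)) : EReal :=
  ⨆ (θ : Fin d → SignedMeasure T) (_ : IsRadonVM θ),
    ((pairing y θ : ℝ) : EReal) - Jstar μ h θ

theorem convex_dom {h : T → EuclideanSpace ℝ (Fin d) → EReal} {t : T}
    (hc : Convex ℝ (epigraph (h t))) : Convex ℝ (dom h t) := by
  have himage : dom h t = LinearMap.fst ℝ (EuclideanSpace ℝ (Fin d)) ℝ '' epigraph (h t) := by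
    ext x
    constructor
    · intro hx
      obtain ⟨a, ha, -⟩ := EReal.lt_iff_exists_real_btwn.1 (show h t x < ⊤ from hx)
      exact ⟨(x, a), ha.le, rfl⟩
    · rintro ⟨p, hp, rfl⟩
      exact lt_of_le_of_lt (show h t p.1 ≤ (p.2 : EReal) from hp) (EReal.coe_lt_top _)
  rw [himage]
  exact hc.linear_image _

/-- A solid convex set that comes within `ε` of every point of a closed ball of radius `2 * ε`
contains the concentric open ball of radius `ε`. -/
theorem Convex.ball_subset_of_approx {E : Type*} [NormedAddCommGroup E] [InnerProductSpace ℝ E]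
    [CompleteSpace E] {C : Set E} (hC : Convex ℝ C) (hint : (interior C).Nonempty)
    {x : E} {ε : ℝ} (hε : 0 < ε)
    (happrox : ∀ b ∈ Metric.closedBall x (2 * ε), ∃ c ∈ C, dist b c ≤ ε) :
    Metric.ball x ε ⊆ interior C := by
  rw [← hC.interior_closure_eq_interior_of_nonempty_interior hint]
  refine interior_maximal (fun z hz => ?_) Metric.isOpen_ball
  by_contra hzC
  obtain ⟨f, u, hfu, huz⟩ := geometric_hahn_banach_closed_point hC.closure isClosed_closure hzC
  obtain ⟨w, rfl⟩ := (InnerProductSpace.toDual ℝ E).surjective f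
  simp only [InnerProductSpace.toDual_apply_apply] at hfu huz
  have hscale : 2 * ε / ‖w‖ * ‖w‖ ≤ 2 * ε := by
    rcases eq_or_ne ‖w‖ 0 with hw | hw
    · simp [hw, hε.le]
    · rw [div_mul_cancel₀ _ hw]
  obtain ⟨c, hc, hbc⟩ := happrox (x + (2 * ε / ‖w‖) • w) (by
    rw [mem_closedBall_iff_norm, add_sub_cancel_left, norm_smul, Real.norm_of_nonneg (by positivity)]
    exact hscale)
  have hcu := hfu c (subset_closure hc)
  have hb : ⟪w, x + (2 * ε / ‖w‖) • w⟫ = ⟪w, x⟫ + 2 * ε * ‖w‖ := by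
    rw [inner_add_right, inner_smul_right, real_inner_self_eq_norm_sq]
    rcases eq_or_ne ‖w‖ 0 with hw | hw
    · simp [hw]
    · field_simp
  have hbc' : ⟪w, x + (2 * ε / ‖w‖) • w⟫ - ⟪w, c⟫ ≤ ‖w‖ * ε := by
    rw [← inner_sub_right]
    refine (real_inner_le_norm _ _).trans ?_
    rw [← dist_eq_norm]
    gcongr
  have hzx : ⟪w, z⟫ - ⟪w, x⟫ ≤ ‖w‖ * ε := by
    rw [← inner_sub_right]
    refine (real_inner_le_norm _ _).trans ?_
    rw [← dist_eq_norm]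
    gcongr
    exact (Metric.mem_ball.1 hz).le
  linarith

/-- A continuous selection of the interiors of an inner semicontinuous solid convex-valued mapping
is locally uniformly interior. -/
theorem InnerSemicontinuous.eventually_ball_subset [TopologicalSpace T]
    {E : Type*} [NormedAddCommGroup E] [InnerProductSpace ℝ E] [FiniteDimensional ℝ E]
    {Γ : T → Set E} (hΓ : InnerSemicontinuous Γ) (hconv : ∀ t, Convex ℝ (Γ t))
    (hsolid : ∀ t, (interior (Γ t)).Nonempty) {y : T → E} (hy : Continuous y) {s : T}
    (hs : y s ∈ interior (Γ s)) :
    ∃ r > 0, ∀ᶠ t in 𝓝 s, Metric.ball (y t) r ⊆ Γ t := by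
  obtain ⟨R, hR, hRs⟩ := Metric.isOpen_iff.1 isOpen_interior _ hs
  obtain ⟨ε, hε, hεR⟩ : ∃ ε > 0, 2 * ε < R := ⟨R / 4, by positivity, by linarith⟩
  obtain ⟨net, hnet, hfin, hcover⟩ :=
    (isCompact_closedBall (y s) (2 * ε)).finite_cover_balls (half_pos hε)
  have hnear : ∀ᶠ t in 𝓝 s, ∀ v ∈ net, (Γ t ∩ Metric.ball v (ε / 2)).Nonempty := by
    refine (eventually_all_finite hfin).2 fun v hv => ?_
    refine (hΓ _ Metric.isOpen_ball).mem_nhds ⟨v, interior_subset (hRs ?_), ?_⟩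
    · exact Metric.closedBall_subset_ball hεR (hnet hv)
    · exact Metric.mem_ball_self (half_pos hε)
  refine ⟨ε / 2, half_pos hε, ?_⟩
  filter_upwards [hnear, hy.continuousAt.eventually (Metric.ball_mem_nhds (y s) (half_pos hε))]
    with t ht hyt
  have hball : Metric.ball (y s) ε ⊆ interior (Γ t) := by
    refine (hconv t).ball_subset_of_approx (hsolid t) hε fun b hb => ?_
    obtain ⟨v, hv, hbv⟩ := mem_iUnion₂.1 (hcover hb)
    obtain ⟨c, hc, hcv⟩ := ht v hv
    refine ⟨c, hc, ?_⟩
    linarith [dist_triangle_right b c v, Metric.mem_ball.1 hbv, Metric.mem_ball.1 hcv]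
  refine (Metric.ball_subset_ball' ?_).trans (hball.trans interior_subset)
  linarith [Metric.mem_ball.1 hyt]

theorem InnerSemicontinuous.exists_ball_subset [TopologicalSpace T] [CompactSpace T]
    {E : Type*} [NormedAddCommGroup E] [InnerProductSpace ℝ E] [FiniteDimensional ℝ E]
    {Γ : T → Set E} (hΓ : InnerSemicontinuous Γ) (hconv : ∀ t, Convex ℝ (Γ t))
    (hsolid : ∀ t, (interior (Γ t)).Nonempty) {y : T → E} (hy : Continuous y)
    (hyΓ : ∀ t, y t ∈ interior (Γ t)) :
    ∃ r > 0, ∀ t, Metric.ball (y t) r ⊆ Γ t := by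
  have huniv : ∃ r > 0, ∀ t ∈ (univ : Set T), Metric.ball (y t) r ⊆ Γ t := by
    refine isCompact_univ.induction_on (p := fun s => ∃ r > 0, ∀ t ∈ s, Metric.ball (y t) r ⊆ Γ t)
      ⟨1, one_pos, by simp⟩ ?_ ?_ ?_
    · rintro s s' hss ⟨r, hr, H⟩
      exact ⟨r, hr, fun t ht => H t (hss ht)⟩
    · rintro s s' ⟨r, hr, H⟩ ⟨r', hr', H'⟩
      refine ⟨min r r', lt_min hr hr', ?_⟩
      rintro t (ht | ht)
      · exact (Metric.ball_subset_ball (min_le_left _ _)).trans (H t ht)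
      · exact (Metric.ball_subset_ball (min_le_right _ _)).trans (H' t ht)
    · intro s _
      obtain ⟨r, hr, H⟩ := hΓ.eventually_ball_subset hconv hsolid hy (hyΓ s)
      exact ⟨_, mem_nhdsWithin_of_mem_nhds H, r, hr, fun t ht => ht⟩
  simpa using huniv

theorem IsConvexNormalIntegrand.measurable_comp [MeasurableSpace T]
    {h : T → EuclideanSpace ℝ (Fin d) → EReal} (hh : IsConvexNormalIntegrand h)
    {y : T → EuclideanSpace ℝ (Fin d)} (hy : Measurable y) :
    Measurable fun t => h t (y t) := by
  have hdist : ∀ p, Measurable fun t => Metric.infEDist p (epigraph (h t)) := by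
    refine fun p => measurable_of_Iio fun c => ?_
    convert hh.2 (Metric.eball p c) Metric.isOpen_eball using 1
    ext t
    simp only [mem_preimage, mem_Iio, Metric.infEDist_lt_iff, mem_ofPred_eq, Set.Nonempty,
      mem_inter_iff, Metric.mem_eball, edist_comm p]
  have hjoint := measurable_uncurry_of_continuous_of_measurable
    (u := fun p t => Metric.infEDist p (epigraph (h t)))
    (fun t => Metric.continuous_infEDist) hdist
  have hreal : ∀ a : ℝ, MeasurableSet {t | h t (y t) ≤ a} := by
    intro a
    have hpair : Measurable fun t => ((y t, a), t) :=
      (hy.prodMk measurable_const).prodMk measurable_id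
    have hm : Measurable fun t => Metric.infEDist (y t, a) (epigraph (h t)) := by
      simpa only [Function.comp_def, Function.uncurry_apply_pair] using hjoint.comp hpair
    convert hm (measurableSet_singleton 0) using 1
    ext t
    rw [mem_preimage, mem_singleton_iff, ← Metric.mem_closure_iff_infEDist_zero,
      (hh.1 t).1.closure_eq]
    rfl
  refine measurable_of_Iio fun c => ?_
  have hunion : (fun t => h t (y t)) ⁻¹' Iio c
      = ⋃ (q : ℚ) (_ : ((q : ℝ) : EReal) < c), {t | h t (y t) ≤ ((q : ℝ) : EReal)} := by
    ext t
    simp only [mem_preimage, mem_Iio, mem_iUnion, mem_ofPred_eq, exists_prop]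
    constructor
    · intro ht
      obtain ⟨q, hq, hqc⟩ := EReal.lt_iff_exists_rat_btwn.1 ht
      exact ⟨q, hqc, hq.le⟩
    · rintro ⟨q, hqc, hq⟩
      exact hq.trans_lt hqc
  rw [hunion]
  exact MeasurableSet.iUnion fun q => MeasurableSet.iUnion fun _ => hreal q

theorem EReal.measurable_abs : Measurable EReal.abs :=
  EReal.measurable_of_measurable_real <| by
    simpa only [EReal.abs_def, Function.comp_def] using
      ENNReal.measurable_ofReal.comp _root_.measurable_abs

theorem ae_lt_top_of_eIntegral_lt_top [MeasurableSpace T] {μ : Measure T} {f : T → EReal}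
    (hf : Measurable f) (hlt : eIntegral μ f < ⊤) : ∀ᵐ t ∂μ, f t < ⊤ := by
  have hpos : (∫⁻ t, ((f t) ⊔ 0).abs ∂μ) ≠ ⊤ := by
    intro htop
    simp [eIntegral, htop] at hlt
  have hm : Measurable fun t => ((f t) ⊔ 0).abs :=
    EReal.measurable_abs.comp (hf.sup measurable_const)
  filter_upwards [ae_lt_top hm hpos] with t ht
  rw [lt_top_iff_ne_top]
  intro hft
  simp [hft] at ht

/-- If almost every value of `Γ` contains a ball of fixed radius around a continuous `y`, then the
μ-inner limit at every point contains the ball of half that radius. -/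
theorem ball_subset_muInnerLimit [TopologicalSpace T] [MeasurableSpace T] [OpensMeasurableSpace T]
    {E : Type*} [PseudoMetricSpace E] {μ : Measure T} {Γ : T → Set E} {y : T → E}
    (hy : Continuous y) {ε : ℝ} (hε : 0 < ε)
    (hball : ∀ᵐ t ∂μ, Metric.ball (y t) ε ⊆ Γ t) (s : T) :
    Metric.ball (y s) (ε / 2) ⊆ muInnerLimit μ Γ s := by
  obtain ⟨M, hM, hMm, hMμ⟩ := exists_measurable_superset_of_null (ae_iff.1 hball)
  set U := y ⁻¹' Metric.ball (y s) (ε / 2)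
  have hU : IsOpen U := Metric.isOpen_ball.preimage hy
  refine subset_iInter₂ fun B hB => ?_
  have hmem : Mᶜ ∩ U ∈ Hmu μ s := by
    refine ⟨hMm.compl.inter hU.measurableSet, U,
      hU.mem_nhds (Metric.mem_ball_self (half_pos hε)), ?_⟩
    rw [inter_assoc, inter_self, inter_comm]
    exact measure_inter_conull (by rwa [compl_compl])
  obtain ⟨t, htB, htM, htU⟩ := hB.2 _ hmem
  have ht : Metric.ball (y t) ε ⊆ Γ t := by
    by_contra hcon
    exact htM (hM hcon)
  refine Subset.trans ?_ subset_closure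
  refine (Metric.ball_subset_ball' ?_).trans (ht.trans (subset_biUnion_of_mem htB))
  linarith [Metric.mem_ball'.1 htU]

/-- for compact `T ⊂ ℝⁿ`, if `dom h` is outer μ-regular then the
interior of `dom I_h` in the supremum norm topology of `C(T;ℝᵈ)` equals
`C(T; int dom h)`. -/
theorem interior_domIh_eq {n d : ℕ}
    (T : Set (EuclideanSpace ℝ (Fin n))) [CompactSpace ↥T]
    (μ : Measure ↥T) [SigmaFinite μ] [μ.InnerRegular] (hμ : StrictlyPositive μ)
    (h : ↥T → EuclideanSpace ℝ (Fin d) → EReal) (hh : IsConvexNormalIntegrand h)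
    (hisc : InnerSemicontinuous (dom h))
    (hsolid : ∀ t, (interior (dom h t)).Nonempty)
    (hfin : ∀ y : ↥T → EuclideanSpace ℝ (Fin d), Continuous y →
      (∃ r > (0:ℝ), ∀ᵐ t ∂μ, Metric.ball (y t) r ⊆ dom h t) →
      Ih μ h y ≠ ⊤ ∧ Ih μ h y ≠ ⊥)
    (hreg : OuterMuRegular μ (dom h)) :
    interior {y : C(↥T, EuclideanSpace ℝ (Fin d)) | Ih μ h ⇑y < ⊤}
      = {y : C(↥T, EuclideanSpace ℝ (Fin d)) | ∀ t, y t ∈ interior (dom h t)} := by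
  have hconv : ∀ t, Convex ℝ (dom h t) := fun t => convex_dom (hh.1 t).2
  refine Subset.antisymm (fun y hy t => ?_) (fun y hy => ?_)
  · obtain ⟨R, hR, hRs⟩ := Metric.isOpen_iff.1 isOpen_interior _ hy
    obtain ⟨ε, hε, hεR⟩ : ∃ ε > 0, 2 * ε < R := ⟨R / 4, by positivity, by linarith⟩
    obtain ⟨net, hnet, hfinite, hcover⟩ :=
      (isCompact_closedBall (0 : EuclideanSpace ℝ (Fin d)) (2 * ε)).finite_cover_balls hε
    have hdom : ∀ᵐ s ∂μ, ∀ v ∈ net, y s + v ∈ dom h s := by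
      refine (eventually_all_finite hfinite).2 fun v hv => ?_
      have hdist : y + ContinuousMap.const ↥T v ∈ Metric.ball y R := by
        refine (ContinuousMap.dist_lt_iff hR).2 fun s => ?_
        simpa using (mem_closedBall_zero_iff.1 (hnet hv)).trans_lt hεR
      have hmem : y + ContinuousMap.const ↥T v
          ∈ {z : C(↥T, EuclideanSpace ℝ (Fin d)) | Ih μ h ⇑z < ⊤} :=
        interior_subset (hRs hdist)
      exact ae_lt_top_of_eIntegral_lt_top
        (hh.measurable_comp (map_continuous (y + ContinuousMap.const ↥T v)).measurable) hmem
    have hball : ∀ᵐ s ∂μ, Metric.ball (y s) ε ⊆ dom h s := by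
      filter_upwards [hdom] with s hs
      refine ((hconv s).ball_subset_of_approx (hsolid s) hε fun b hb => ?_).trans interior_subset
      have hb' : b - y s ∈ Metric.closedBall (0 : EuclideanSpace ℝ (Fin d)) (2 * ε) := by
        rwa [mem_closedBall_zero_iff, ← mem_closedBall_iff_norm]
      obtain ⟨v, hv, hbv⟩ := mem_iUnion₂.1 (hcover hb')
      refine ⟨y s + v, hs v hv, ?_⟩
      rw [dist_eq_norm, ← sub_sub, ← dist_eq_norm]
      exact (Metric.mem_ball.1 hbv).le
    rw [← (hconv t).interior_closure_eq_interior_of_nonempty_interior (hsolid t)]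
    exact interior_maximal ((ball_subset_muInnerLimit y.continuous hε hball t).trans (hreg t))
      Metric.isOpen_ball (Metric.mem_ball_self (half_pos hε))
  · obtain ⟨r, hr, hball⟩ := hisc.exists_ball_subset hconv hsolid y.continuous hy
    refine mem_interior.2 ⟨Metric.ball y (r / 2), fun z hz => ?_, Metric.isOpen_ball,
      Metric.mem_ball_self (half_pos hr)⟩
    refine lt_top_iff_ne_top.2
      (hfin z z.continuous ⟨r / 2, half_pos hr, Eventually.of_forall fun t => ?_⟩).1
    refine (Metric.ball_subset_ball' ?_).trans (hball t)
    linarith [ContinuousMap.dist_apply_le_dist (f := z) (g := y) t, Metric.mem_ball.1 hz]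

end
end
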